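/- Let d ∈ {1, 2, 4, 8}. Let M be a smooth (C^∞) manifold without boundary, modeled on ℝⁿ, which is Hausdorff, second countable, and contractible. Let Y ⊆ M be a closed set, U ⊆ M an open set containing Y, and f : U → ℝᵈ a C^∞ map such that Y = {x ∈ U : f(x) = 0} and the differential of f at each point x ∈ Y is a surjective linear map onto ℝᵈ. Then there exists a C^∞ map F : M → ℝᵈ such that Y = {x ∈ M : F(x) = 0} and the differential of F is surjective at every point of Y. -/

import Mathlib

open scoped Manifold

set_option maxHeartbeats 4000000 in
/-- Left multiplication in a real division algebra of dimension 1, 2, 4, 8. -/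
lemma dci_exists_mul (d : ℕ) (hd : d ∈ ({1, 2, 4, 8} : Set ℕ)) :
    ∃ (L : EuclideanSpace ℝ (Fin d) →ₗ[ℝ] EuclideanSpace ℝ (Fin d) →ₗ[ℝ]
        EuclideanSpace ℝ (Fin d)) (l : EuclideanSpace ℝ (Fin d) →ₗ[ℝ] ℝ)
      (e : EuclideanSpace ℝ (Fin d)), e ≠ 0 ∧ (∀ b, L b e = b) ∧
      ∀ b v, L b (L b v) = l b • L b v - ‖b‖ ^ 2 • v := by
  simp only [Set.mem_insert_iff, Set.mem_singleton_iff] at hd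
  rcases hd with rfl | rfl | rfl | rfl
  · refine ⟨LinearMap.mk₂ ℝ (fun b v => !₂[b 0 * v 0]) ?_ ?_ ?_ ?_,
      (2 : ℝ) • (EuclideanSpace.proj (0 : Fin 1) : EuclideanSpace ℝ (Fin 1) →L[ℝ] ℝ).toLinearMap,
      !₂[1], ?_, ?_, ?_⟩
    · intro a b c; ext i; fin_cases i <;> simp <;> ring
    · intro a b c; ext i; fin_cases i <;> simp <;> ring
    · intro a b c; ext i; fin_cases i <;> simp <;> ring
    · intro a b c; ext i; fin_cases i <;> simp <;> ring
    · intro h; have := congrArg (fun v => v 0) h; simp at this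
    · intro b; ext i; fin_cases i <;> simp
    · intro b v; ext i; fin_cases i <;> simp [EuclideanSpace.norm_sq_eq] <;> ring
  · refine ⟨LinearMap.mk₂ ℝ (fun b v => !₂[b 0 * v 0 - b 1 * v 1, b 0 * v 1 + b 1 * v 0])
      ?_ ?_ ?_ ?_,
      (2 : ℝ) • (EuclideanSpace.proj (0 : Fin 2) : EuclideanSpace ℝ (Fin 2) →L[ℝ] ℝ).toLinearMap,
      !₂[1, 0], ?_, ?_, ?_⟩
    · intro a b c; ext i; fin_cases i <;> simp <;> ring
    · intro a b c; ext i; fin_cases i <;> simp <;> ring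
    · intro a b c; ext i; fin_cases i <;> simp <;> ring
    · intro a b c; ext i; fin_cases i <;> simp <;> ring
    · intro h; have := congrArg (fun v => v 0) h; simp at this
    · intro b; ext i; fin_cases i <;> simp
    · intro b v; ext i; fin_cases i <;> simp [EuclideanSpace.norm_sq_eq] <;> ring
  · refine ⟨LinearMap.mk₂ ℝ (fun b v => !₂[
        b 0 * v 0 - b 1 * v 1 - b 2 * v 2 - b 3 * v 3,
        b 0 * v 1 + b 1 * v 0 + b 2 * v 3 - b 3 * v 2,
        b 0 * v 2 - b 1 * v 3 + b 2 * v 0 + b 3 * v 1,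
        b 0 * v 3 + b 1 * v 2 - b 2 * v 1 + b 3 * v 0])
      ?_ ?_ ?_ ?_,
      (2 : ℝ) • (EuclideanSpace.proj (0 : Fin 4) : EuclideanSpace ℝ (Fin 4) →L[ℝ] ℝ).toLinearMap,
      !₂[1, 0, 0, 0], ?_, ?_, ?_⟩
    · intro a b c; ext i; fin_cases i <;> simp <;> ring
    · intro a b c; ext i; fin_cases i <;> simp <;> ring
    · intro a b c; ext i; fin_cases i <;> simp <;> ring
    · intro a b c; ext i; fin_cases i <;> simp <;> ring
    · intro h; have := congrArg (fun v => v 0) h; simp at this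
    · intro b; ext i; fin_cases i <;> simp
    · intro b v; ext i
      fin_cases i <;> simp [EuclideanSpace.norm_sq_eq, Fin.sum_univ_four] <;> ring
  · refine ⟨LinearMap.mk₂ ℝ (fun b v => !₂[
        b 0 * v 0 - b 1 * v 1 - b 2 * v 2 - b 3 * v 3 - b 4 * v 4
          - b 5 * v 5 - b 6 * v 6 - b 7 * v 7,
        b 0 * v 1 + b 1 * v 0 + b 2 * v 3 - b 3 * v 2 + b 4 * v 5
          - b 5 * v 4 - b 6 * v 7 + b 7 * v 6,
        b 0 * v 2 - b 1 * v 3 + b 2 * v 0 + b 3 * v 1 + b 4 * v 6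
          + b 5 * v 7 - b 6 * v 4 - b 7 * v 5,
        b 0 * v 3 + b 1 * v 2 - b 2 * v 1 + b 3 * v 0 + b 4 * v 7
          - b 5 * v 6 + b 6 * v 5 - b 7 * v 4,
        b 0 * v 4 - b 1 * v 5 - b 2 * v 6 - b 3 * v 7 + b 4 * v 0
          + b 5 * v 1 + b 6 * v 2 + b 7 * v 3,
        b 0 * v 5 + b 1 * v 4 - b 2 * v 7 + b 3 * v 6 - b 4 * v 1
          + b 5 * v 0 - b 6 * v 3 + b 7 * v 2,
        b 0 * v 6 + b 1 * v 7 + b 2 * v 4 - b 3 * v 5 - b 4 * v 2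
          + b 5 * v 3 + b 6 * v 0 - b 7 * v 1,
        b 0 * v 7 - b 1 * v 6 + b 2 * v 5 + b 3 * v 4 - b 4 * v 3
          - b 5 * v 2 + b 6 * v 1 + b 7 * v 0])
      ?_ ?_ ?_ ?_,
      (2 : ℝ) • (EuclideanSpace.proj (0 : Fin 8) : EuclideanSpace ℝ (Fin 8) →L[ℝ] ℝ).toLinearMap,
      !₂[1, 0, 0, 0, 0, 0, 0, 0], ?_, ?_, ?_⟩
    · intro a b c; ext i; fin_cases i <;> simp <;> ring
    · intro a b c; ext i; fin_cases i <;> simp <;> ring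
    · intro a b c; ext i; fin_cases i <;> simp <;> ring
    · intro a b c; ext i; fin_cases i <;> simp <;> ring
    · intro h; have := congrArg (fun v => v 0) h; simp at this
    · intro b; ext i; fin_cases i <;> simp
    · intro b v; ext i
      fin_cases i <;> simp [EuclideanSpace.norm_sq_eq, Fin.sum_univ_eight] <;> ring

open Filter Topology in
/-- Transport of involutions along a path, continuous in parameters. -/
lemma dci_transport {M A : Type*} [TopologicalSpace M] [NormedRing A] [NormedAlgebra ℝ A]
    (c : M × ℝ → A) (hc : Continuous c) (hsq : ∀ p, c p * c p = 1)
    (hc1 : ∀ x t, 1 ≤ t → c (x, t) = c (x, 1))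
    (δ : M → ℝ) (hδ : Continuous δ) (hpos : ∀ x, 0 < δ x)
    (hu : ∀ x s, 0 ≤ s → IsUnit (1 + c (x, s + δ x) * c (x, s))) :
    ∃ T : M → A, Continuous T ∧ (∀ x, IsUnit (T x)) ∧
      ∀ x, T x * c (x, 0) = c (x, 1) * T x := by
  let G : ℕ → M → A := fun k => Nat.rec (fun _ => 1)
    (fun k g x => ((2 : ℝ)⁻¹ • (1 + c (x, k * δ x + δ x) * c (x, k * δ x))) * g x) k
  have G0 : ∀ x, G 0 x = 1 := fun x => rfl
  have Gs : ∀ k x, G (k + 1) x =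
    ((2 : ℝ)⁻¹ • (1 + c (x, k * δ x + δ x) * c (x, k * δ x))) * G k x := fun k x => rfl
  have hGc : ∀ k, Continuous (G k) := by
    intro k
    induction k with
    | zero => exact continuous_const
    | succ k ih =>
      have : G (k + 1) = fun x =>
        ((2 : ℝ)⁻¹ • (1 + c (x, k * δ x + δ x) * c (x, k * δ x))) * G k x := rfl
      rw [this]
      fun_prop
  have hGu : ∀ k x, IsUnit (G k x) := by
    intro k x
    induction k with
    | zero => exact isUnit_one
    | succ k ih =>
      rw [Gs]
      refine IsUnit.mul ?_ ih
      have h := hu x (k * δ x) (mul_nonneg k.cast_nonneg (hpos x).le)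
      exact h.smul (Units.mk0 (2 : ℝ)⁻¹ (by norm_num))
  have hGt : ∀ k x, G k x * c (x, 0) = c (x, k * δ x) * G k x := by
    intro k x
    induction k with
    | zero => simp [G0]
    | succ k ih =>
      rw [Gs, mul_assoc, ih, ← mul_assoc, ← mul_assoc]
      congr 1
      have e : ((k + 1 : ℕ) : ℝ) * δ x = k * δ x + δ x := by push_cast; ring
      rw [e, smul_mul_assoc, mul_smul_comm, add_mul, mul_add, mul_assoc, hsq, ← mul_assoc, hsq]
      simp [add_comm]
  have hGst : ∀ (k : ℕ) x, 1 ≤ k * δ x → G (k + 1) x = G k x := by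
    intro k x h
    rw [Gs, hc1 x _ h, hc1 x (k * δ x + δ x) (by linarith [hpos x]), hsq, ← two_smul ℝ (1 : A),
      smul_smul]
    norm_num
  have hGst' : ∀ (k m : ℕ) x, k ≤ m → 1 ≤ k * δ x → G m x = G k x := by
    intro k m x hkm h
    induction m, hkm using Nat.le_induction with
    | base => rfl
    | succ m hm ih =>
      rw [hGst, ih]
      refine h.trans ?_
      gcongr
      exact (hpos x).le
  have hN : ∀ x, 1 ≤ (⌈(δ x)⁻¹⌉₊ : ℝ) * δ x := by
    intro x
    have := Nat.le_ceil (δ x)⁻¹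
    calc (1 : ℝ) = (δ x)⁻¹ * δ x := by rw [inv_mul_cancel₀ (hpos x).ne']
      _ ≤ _ := by gcongr; exact (hpos x).le
  refine ⟨fun x => G ⌈(δ x)⁻¹⌉₊ x, ?_, fun x => hGu _ _, fun x => ?_⟩
  · rw [continuous_iff_continuousAt]
    intro x₀
    set N := ⌈(δ x₀)⁻¹⌉₊ + 1 with hNdef
    have h1 : (1 : ℝ) < N * δ x₀ := by
      have := hN x₀
      have := hpos x₀
      rw [hNdef]; push_cast; linarith
    have ev : ∀ᶠ x in 𝓝 x₀, (1 : ℝ) < N * δ x :=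
      (continuous_const.mul hδ).continuousAt.eventually_const_lt h1
    refine ((hGc N).continuousAt).congr ?_
    filter_upwards [ev] with x hx
    refine hGst' ⌈(δ x)⁻¹⌉₊ N x ?_ (hN x)
    rw [Nat.ceil_le, inv_le_iff_one_le_mul₀ (hpos x)]
    linarith
  · rw [hGt, hc1 x _ (hN x)]

lemma dci_hasMFDerivAt {n : ℕ} {M : Type*} [TopologicalSpace M]
    [ChartedSpace (EuclideanSpace ℝ (Fin n)) M]
    {E F : Type*} [NormedAddCommGroup E] [NormedSpace ℝ E] [NormedAddCommGroup F]
    [NormedSpace ℝ F] (g : M → E →L[ℝ] F) (s : M → E) (y : M)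
    (hg : MDifferentiableAt (𝓡 n) 𝓘(ℝ, E →L[ℝ] F) g y)
    (hs : MDifferentiableAt (𝓡 n) 𝓘(ℝ, E) s y) (h0 : s y = 0) :
    ∀ ξ, mfderiv (𝓡 n) 𝓘(ℝ, F) (fun x => g x (s x)) y ξ = g y (mfderiv (𝓡 n) 𝓘(ℝ, E) s y ξ) := by
  intro ξ
  have h1 := hg.hasMFDerivAt
  have h2 := hs.hasMFDerivAt
  have h3 : HasMFDerivAt (𝓡 n) 𝓘(ℝ, F) (fun x => g x (s x)) y
      ((g y).comp (mfderiv (𝓡 n) 𝓘(ℝ, E) s y : EuclideanSpace ℝ (Fin n) →L[ℝ] E) :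
        EuclideanSpace ℝ (Fin n) →L[ℝ] F) := by
    refine ⟨h1.1.clm_apply h2.1, ?_⟩
    have := HasFDerivWithinAt.clm_apply h1.2 h2.2
    have e1 : writtenInExtChartAt (𝓡 n) 𝓘(ℝ, E →L[ℝ] F) y g (extChartAt (𝓡 n) y y) = g y := by
      simp [writtenInExtChartAt]
      rfl
    have e2 : writtenInExtChartAt (𝓡 n) 𝓘(ℝ, E) y s (extChartAt (𝓡 n) y y) = 0 := by
      simp [writtenInExtChartAt, h0]
      rfl
    rw [e1, e2, map_zero, add_zero] at this
    exact this
  rw [h3.mfderiv]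
  rfl

open Filter Topology in
/-- Homotopy invariance: an involution-valued map on a contractible manifold is smoothly
conjugate to a constant. -/
lemma dci_trivialize {n : ℕ} {M : Type*} [TopologicalSpace M]
    [ChartedSpace (EuclideanSpace ℝ (Fin n)) M]
    [IsManifold (𝓡 n) (⊤ : ℕ∞) M] [T2Space M] [SecondCountableTopology M]
    [ContractibleSpace M] {A : Type*} [NormedRing A] [NormedAlgebra ℝ A] [CompleteSpace A]
    (C : M → A) (hC : ContMDiff (𝓡 n) 𝓘(ℝ, A) (⊤ : ℕ∞) C) (hsq : ∀ x, C x * C x = 1) (x₀ : M) :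
    ∃ W : M → A, ContMDiff (𝓡 n) 𝓘(ℝ, A) (⊤ : ℕ∞) W ∧ (∀ x, IsUnit (W x)) ∧
      ∀ x, W x * C x = C x₀ * W x := by
  have : LocallyCompactSpace M := ChartedSpace.locallyCompactSpace (EuclideanSpace ℝ (Fin n)) M
  have : SigmaCompactSpace M := inferInstance
  have hCc : Continuous C := hC.continuous
  obtain ⟨p, ⟨H⟩⟩ := id_nullhomotopic M
  let c : M × ℝ → A := fun q => C (H (Set.projIcc 0 1 zero_le_one q.2, q.1))
  have hc : Continuous c := by
    have : Continuous (Set.projIcc (0 : ℝ) 1 zero_le_one) := continuous_projIcc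
    fun_prop
  have hcsq : ∀ q, c q * c q = 1 := fun q => hsq _
  have hc0 : ∀ x, c (x, 0) = C x := by
    intro x
    simp [c]
  have hc1' : ∀ x t, 1 ≤ t → c (x, t) = C p := by
    intro x t ht
    simp [c, Set.projIcc_of_right_le _ ht]
  have hc1 : ∀ x t, 1 ≤ t → c (x, t) = c (x, 1) := by
    intro x t ht
    rw [hc1' x t ht, hc1' x 1 le_rfl]
  have h2 : IsUnit ((1 : A) + 1) := by
    have : ((1 : A) + 1) = (Units.mk0 (2 : ℝ) (by norm_num)) • (1 : A) := by
      rw [Units.smul_def, ← two_smul ℝ (1 : A)]; rfl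
    rw [this]
    exact isUnit_one.smul _
  obtain ⟨δ, hδ⟩ := exists_contMDiffMap_forall_mem_convex_of_local_const (n := (⊤ : ℕ∞)) (𝓡 n)
    (t := fun x : M => {ε : ℝ | 0 < ε ∧ ∀ s t : ℝ, 0 ≤ s → s ≤ 1 → 0 ≤ t → t ≤ ε →
      IsUnit (1 + c (x, s + t) * c (x, s))}) (by
      intro x
      apply Set.OrdConnected.convex
      refine ⟨fun a ha b hb z hz => ⟨ha.1.trans_le hz.1, fun s t h1 h2 h3 h4 => ?_⟩⟩
      exact hb.2 s t h1 h2 h3 (h4.trans hz.2)) (by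
      intro x
      let O : Set (M × (ℝ × ℝ)) :=
        {q | IsUnit (1 + c (q.1, q.2.1 + q.2.2) * c (q.1, q.2.1))}
      have hO : IsOpen O := by
        have : Continuous fun q : M × (ℝ × ℝ) =>
          1 + c (q.1, q.2.1 + q.2.2) * c (q.1, q.2.1) := by fun_prop
        exact Units.isOpen.preimage this
      have hsub : ({x} : Set M) ×ˢ (Set.Icc (0 : ℝ) 1 ×ˢ ({0} : Set ℝ)) ⊆ O := by
        rintro ⟨y, s, t⟩ ⟨hy, hs, ht⟩
        simp only [Set.mem_singleton_iff] at hy ht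
        simp only at hs
        subst ht
        simp [O, hcsq, h2]
      obtain ⟨u, v, hu, hv, hxu, hIv, huv⟩ := generalized_tube_lemma isCompact_singleton
        (isCompact_Icc.prod isCompact_singleton) hO hsub
      obtain ⟨u', v', hu', hv', hIu', h0v', huv'⟩ := generalized_tube_lemma
        (isCompact_Icc (a := (0 : ℝ)) (b := 1)) (isCompact_singleton (x := (0 : ℝ))) hv hIv
      obtain ⟨ε, hε, hball⟩ := Metric.isOpen_iff.1 hv' 0 (h0v' rfl)
      refine ⟨ε / 2, ?_⟩
      filter_upwards [hu.mem_nhds (hxu rfl)] with y hy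
      refine ⟨by positivity, fun s t h1 h2 h3 h4 => ?_⟩
      have : (y, (s, t)) ∈ O := by
        apply huv
        refine ⟨hy, huv' ⟨hIu' ⟨h1, h2⟩, hball ?_⟩⟩
        rw [Metric.mem_ball, dist_zero_right, Real.norm_of_nonneg h3]
        linarith
      exact this)
  obtain ⟨T, hTc, hTu, hT⟩ := dci_transport c hc hcsq hc1 δ δ.contMDiff.continuous
    (fun x => (hδ x).1) (fun x s hs => by
      rcases le_total s 1 with h | h
      · exact (hδ x).2 s (δ x) hs h (hδ x).1.le le_rfl
      · rw [hc1 x s h, hc1 x (s + δ x) (by linarith [(hδ x).1]), hcsq]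
        exact h2)
  have hT' : ∀ x, T x * C x = C p * T x := fun x => by
    rw [← hc0 x, hT x, hc1' x 1 le_rfl]
  have key : ∀ x, (2 : ℝ)⁻¹ • (T x + C p * T x * C x) = T x := by
    intro x
    rw [← hT' x, mul_assoc, hsq, mul_one, ← two_smul ℝ (T x), smul_smul]
    norm_num
  have hinv : Continuous fun x => Ring.inverse (T x) := by
    rw [continuous_iff_continuousAt]
    intro x
    obtain ⟨w, hw⟩ := hTu x
    have := NormedRing.inverse_continuousAt w
    rw [hw] at this
    exact ContinuousAt.comp this hTc.continuousAt
  obtain ⟨S, hS⟩ := exists_contMDiffMap_forall_mem_convex_of_local_const (n := (⊤ : ℕ∞)) (𝓡 n)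
    (t := fun x : M => {B : A | ‖Ring.inverse (T x) * ((2 : ℝ)⁻¹ • (B + C p * B * C x)) - 1‖ < 1})
    (by
      intro x
      intro B₁ h₁ B₂ h₂ a b ha hb hab
      have hcv := convex_ball (1 : A) 1
      have := hcv (mem_ball_iff_norm.2 h₁) (mem_ball_iff_norm.2 h₂) ha hb hab
      rw [mem_ball_iff_norm] at this
      refine lt_of_eq_of_lt ?_ this
      congr 2
      simp only [mul_add, add_mul, smul_add, mul_smul_comm, smul_mul_assoc]
      simp only [smul_comm (2 : ℝ)⁻¹]
      abel) (by
      intro x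
      refine ⟨T x, ?_⟩
      have hcont : Continuous fun y =>
        ‖Ring.inverse (T y) * ((2 : ℝ)⁻¹ • (T x + C p * T x * C y)) - 1‖ := by fun_prop
      refine hcont.continuousAt.eventually_lt_const ?_
      beta_reduce
      rw [key, Ring.inverse_mul_cancel _ (hTu x)]
      simp)
  let W : M → A := fun x => (2 : ℝ)⁻¹ • (S x + C p * S x * C x)
  have hWu : ∀ x, IsUnit (W x) := by
    intro x
    have h := hS x
    have h1 : IsUnit (Ring.inverse (T x) * W x) := by
      have h3 : ‖1 - Ring.inverse (T x) * W x‖ < 1 := by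
        rw [norm_sub_rev]; exact h
      have := isUnit_one_sub_of_norm_lt_one h3
      simpa using this
    have h4 : W x = T x * (Ring.inverse (T x) * W x) := by
      rw [← mul_assoc, Ring.mul_inverse_cancel _ (hTu x), one_mul]
    rw [h4]
    exact (hTu x).mul h1
  have hWC : ∀ x, W x * C x = C p * W x := by
    intro x
    simp only [W]
    rw [smul_mul_assoc, mul_smul_comm, add_mul, mul_add, mul_assoc _ (C x) (C x), hsq,
      ← mul_assoc (C p), ← mul_assoc (C p), hsq]
    simp [add_comm]
  have hWs : ContMDiff (𝓡 n) 𝓘(ℝ, A) (⊤ : ℕ∞) W := by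
    have hΦ : ContDiff ℝ (⊤ : ℕ∞) (fun q : A × A => (2 : ℝ)⁻¹ • (q.1 + C p * q.1 * q.2)) := by
      fun_prop
    exact hΦ.contMDiff.comp (S.contMDiff.prodMk_space hC)
  refine ⟨fun x => Ring.inverse (W x₀) * W x, ?_, fun x => ?_, fun x => ?_⟩
  · have hΦ : ContDiff ℝ (⊤ : ℕ∞) (fun q : A => Ring.inverse (W x₀) * q) := by
      fun_prop
    exact hΦ.contMDiff.comp hWs
  · exact IsUnit.mul (hWu x₀).ringInverse (hWu x)
  · have e : Ring.inverse (W x₀) * C p = C x₀ * Ring.inverse (W x₀) := by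
      have := hWC x₀
      calc Ring.inverse (W x₀) * C p
          = Ring.inverse (W x₀) * (C p * W x₀) * Ring.inverse (W x₀) := by
            rw [mul_assoc, mul_assoc, Ring.mul_inverse_cancel _ (hWu x₀), mul_one]
        _ = _ := by
            rw [← this, ← mul_assoc, Ring.inverse_mul_cancel _ (hWu x₀), one_mul]
    rw [mul_assoc, hWC, ← mul_assoc, e, mul_assoc]

/-- The Clifford map: `K (a, b) (v, w) = (a v + L b w, (l b - L b) v - a w)`. -/
lemma dci_exists_clifford (d : ℕ) (hd : d ∈ ({1, 2, 4, 8} : Set ℕ)) :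
    ∃ (K : (ℝ × EuclideanSpace ℝ (Fin d)) →L[ℝ]
        ((EuclideanSpace ℝ (Fin d) × EuclideanSpace ℝ (Fin d)) →L[ℝ]
          (EuclideanSpace ℝ (Fin d) × EuclideanSpace ℝ (Fin d))))
      (e : EuclideanSpace ℝ (Fin d)), e ≠ 0 ∧
      (∀ a b, K (a, b) (0, e) = (b, - a • e)) ∧
      (∀ v w, K (1, 0) (v, w) = (v, -w)) ∧
      ∀ a b, a ^ 2 + ‖b‖ ^ 2 = 1 → K (a, b) * K (a, b) = 1 := by
  obtain ⟨L, l, e, he, hLe, hL⟩ := dci_exists_mul d hd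
  let V := EuclideanSpace ℝ (Fin d)
  let K₀ : (ℝ × V) →ₗ[ℝ] (V × V) →ₗ[ℝ] (V × V) :=
    LinearMap.mk₂ ℝ (fun p q => (p.1 • q.1 + L p.2 q.2, l p.2 • q.1 - L p.2 q.1 - p.1 • q.2))
      (by
        intro p p' q
        ext1 <;> simp only [Prod.fst_add, Prod.snd_add, map_add, LinearMap.add_apply] <;> module)
      (by
        intro c p q
        ext1 <;> simp only [Prod.smul_fst, Prod.smul_snd, map_smul, LinearMap.smul_apply,
          smul_eq_mul] <;> module)
      (by
        intro p q q'
        ext1 <;> simp only [Prod.fst_add, Prod.snd_add, map_add] <;> module)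
      (by
        intro c p q
        ext1 <;> simp only [Prod.smul_fst, Prod.smul_snd, map_smul] <;> module)
  let K₁ : (ℝ × V) →ₗ[ℝ] (V × V) →L[ℝ] (V × V) :=
    (LinearMap.toContinuousLinearMap (𝕜 := ℝ) (E := V × V) (F' := V × V)).toLinearMap ∘ₗ K₀
  have hK : ∀ a b v w, (LinearMap.toContinuousLinearMap K₁) (a, b) (v, w) =
      (a • v + L b w, l b • v - L b v - a • w) := fun a b v w => rfl
  refine ⟨LinearMap.toContinuousLinearMap K₁, e, he, ?_, ?_, ?_⟩
  · intro a b
    rw [hK]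
    simp [hLe]
  · intro v w
    rw [hK]
    simp
  · intro a b hab
    refine ContinuousLinearMap.ext ?_
    rintro ⟨v, w⟩
    rw [mul_apply_eq_comp, hK, hK, one_apply_eq_self]
    simp only [map_add, map_sub, map_smul, hL]
    have hb : ‖b‖ ^ 2 = 1 - a ^ 2 := by linarith
    rw [hb]
    ext1 <;> dsimp only <;> module

lemma dci_main {d n : ℕ} (hd : d ∈ ({1, 2, 4, 8} : Set ℕ))
    {M : Type*} [TopologicalSpace M] [ChartedSpace (EuclideanSpace ℝ (Fin n)) M]
    [IsManifold (𝓡 n) (⊤ : ℕ∞) M] [T2Space M] [SecondCountableTopology M]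
    [ContractibleSpace M] (a : M → ℝ) (b : M → EuclideanSpace ℝ (Fin d))
    (ha : ContMDiff (𝓡 n) 𝓘(ℝ, ℝ) (⊤ : ℕ∞) a)
    (hb : ContMDiff (𝓡 n) (𝓡 d) (⊤ : ℕ∞) b)
    (hab : ∀ x, a x ^ 2 + ‖b x‖ ^ 2 = 1)
    (hsurj : ∀ x, a x = 1 → Function.Surjective (mfderiv (𝓡 n) (𝓡 d) b x))
    (x₀ : M) (hx₀ : a x₀ = 1) :
    ∃ F : M → EuclideanSpace ℝ (Fin d),
      ContMDiff (𝓡 n) (𝓡 d) (⊤ : ℕ∞) F ∧ (∀ x, F x = 0 ↔ a x = 1) ∧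
      ∀ x, a x = 1 → Function.Surjective (mfderiv (𝓡 n) (𝓡 d) F x) := by
  obtain ⟨K, e, he, hKe, hK1, hKsq⟩ := dci_exists_clifford d hd
  have hb0 : ∀ x, a x = 1 → b x = 0 := by
    intro x hx
    have := hab x
    rw [hx] at this
    have h : ‖b x‖ ^ 2 = 0 := by linarith
    simpa using h
  have hC : ContMDiff (𝓡 n) 𝓘(ℝ, (EuclideanSpace ℝ (Fin d) × EuclideanSpace ℝ (Fin d)) →L[ℝ]
          (EuclideanSpace ℝ (Fin d) × EuclideanSpace ℝ (Fin d))) (⊤ : ℕ∞)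
      (fun x => K (a x, b x)) := K.contDiff.contMDiff.comp (ha.prodMk_space hb)
  obtain ⟨W, hWs, hWu, hW⟩ := dci_trivialize _ hC (fun x => hKsq _ _ (hab x)) x₀
  have hC0 : K (a x₀, b x₀) = K (1, 0) := by rw [hx₀, hb0 x₀ hx₀]
  rw [hC0] at hW
  have hW' : ∀ x q, W x (K (a x, b x) q) = ((W x q).1, - (W x q).2) := by
    intro x q
    rw [← hK1, ← mul_apply_eq_comp, hW]
    rfl
  let s : M → EuclideanSpace ℝ (Fin d) × EuclideanSpace ℝ (Fin d) :=
    fun x => (b x, (1 - a x) • e)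
  have hs : ∀ x, K (a x, b x) (s x) = s x := by
    intro x
    have e1 : s x = (0, e) + K (a x, b x) (0, e) := by
      rw [hKe]
      ext1
      · simp [s]
      · simp only [s, Prod.snd_add]; module
    rw [e1, map_add, ← mul_apply_eq_comp, hKsq _ _ (hab x), add_comm]
    rfl
  have hss : ContMDiff (𝓡 n) 𝓘(ℝ, EuclideanSpace ℝ (Fin d) × EuclideanSpace ℝ (Fin d))
      (⊤ : ℕ∞) s := by
    have hΦ : ContDiff ℝ (⊤ : ℕ∞) (fun q : EuclideanSpace ℝ (Fin d) × ℝ =>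
      (q.1, (1 - q.2) • e)) := by fun_prop
    exact hΦ.contMDiff.comp (hb.prodMk_space ha)
  let g : M → (EuclideanSpace ℝ (Fin d) × EuclideanSpace ℝ (Fin d)) →L[ℝ]
    EuclideanSpace ℝ (Fin d) := fun x => (ContinuousLinearMap.fst ℝ _ _).comp (W x)
  have hg : ContMDiff (𝓡 n) 𝓘(ℝ, (EuclideanSpace ℝ (Fin d) × EuclideanSpace ℝ (Fin d)) →L[ℝ]
    EuclideanSpace ℝ (Fin d)) (⊤ : ℕ∞) g := contMDiff_const.clm_comp hWs
  have hinj : ∀ x q, W x q = 0 → q = 0 := by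
    intro x q hq
    obtain ⟨u, hu⟩ := hWu x
    have h1 : ((u⁻¹ : Units _) : (EuclideanSpace ℝ (Fin d) × EuclideanSpace ℝ (Fin d)) →L[ℝ]
          (EuclideanSpace ℝ (Fin d) × EuclideanSpace ℝ (Fin d))) (W x q) = q := by
      rw [← hu, ← mul_apply_eq_comp, Units.inv_mul]
      rfl
    rw [← h1, hq, map_zero]
  have hsur : ∀ x v, ∃ q, W x q = v := by
    intro x v
    obtain ⟨u, hu⟩ := hWu x
    refine ⟨((u⁻¹ : Units _) : (EuclideanSpace ℝ (Fin d) × EuclideanSpace ℝ (Fin d)) →L[ℝ]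
          (EuclideanSpace ℝ (Fin d) × EuclideanSpace ℝ (Fin d))) v, ?_⟩
    rw [← hu, ← mul_apply_eq_comp, Units.mul_inv]
    rfl
  have hs0 : ∀ x, a x = 1 → s x = 0 := by
    intro x hx
    simp [s, hx, hb0 x hx]
  refine ⟨fun x => g x (s x), hg.clm_apply hss, fun x => ⟨fun h => ?_, fun h => ?_⟩,
    fun y hy => ?_⟩
  · have h1 : (W x (s x)).1 = 0 := h
    have h2 := hW' x (s x)
    rw [hs] at h2
    have h3 : (W x (s x)).2 = - (W x (s x)).2 := congrArg Prod.snd h2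
    have h4 : (W x (s x)).2 = 0 := by
      have h8 : (2 : ℝ) • (W x (s x)).2 = 0 := by rw [two_smul]; nth_rewrite 2 [h3]; simp
      exact (smul_eq_zero.1 h8).resolve_left two_ne_zero
    have h5 := hinj x (s x) (Prod.ext h1 h4)
    have h6 : (1 - a x) • e = 0 := congrArg Prod.snd h5
    rcases smul_eq_zero.1 h6 with h7 | h7
    · linarith
    · exact absurd h7 he
  · simp [hs0 x h]
  · have hne : ((⊤ : ℕ∞) : WithTop ℕ∞) ≠ 0 := by simp
    have hder := dci_hasMFDerivAt g s y ((hg y).mdifferentiableAt hne)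
      ((hss y).mdifferentiableAt hne) (hs0 y hy)
    have hder1 : ∀ ξ, ((mfderiv (𝓡 n) 𝓘(ℝ, EuclideanSpace ℝ (Fin d) × EuclideanSpace ℝ (Fin d))
        s y ξ : EuclideanSpace ℝ (Fin d) × EuclideanSpace ℝ (Fin d))).1 =
        mfderiv (𝓡 n) (𝓡 d) b y ξ := by
      intro ξ
      have hh := dci_hasMFDerivAt (fun _ : M => ContinuousLinearMap.fst ℝ
        (EuclideanSpace ℝ (Fin d)) (EuclideanSpace ℝ (Fin d))) s y mdifferentiableAt_const
        ((hss y).mdifferentiableAt hne) (hs0 y hy) ξ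
      exact hh.symm
    have hW1 : ∀ q, W y (q.1, - q.2) = ((W y q).1, - (W y q).2) := by
      intro q
      have := hW' y q
      rwa [hy, hb0 y hy, hK1] at this
    have hgy : ∀ v w, g y (v, w) = g y (v, 0) := by
      intro v w
      have h1 : (W y (v, -w)).1 = (W y (v, w)).1 := by
        have h0 := hW1 (v, w)
        dsimp only at h0
        rw [h0]
      have h2 : (v, (0 : EuclideanSpace ℝ (Fin d))) = (2 : ℝ)⁻¹ • ((v, w) + (v, -w)) := by
        ext1
        · simp only [Prod.smul_fst, Prod.fst_add]; module
        · simp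
      change (W y (v, w)).1 = (W y (v, 0)).1
      rw [h2, map_smul, map_add, Prod.smul_fst, Prod.fst_add, h1]
      module
    intro v
    obtain ⟨⟨q1, q2⟩, hq⟩ := hsur y (v, 0)
    obtain ⟨ξ, hξ⟩ := hsurj y hy q1
    refine ⟨ξ, ?_⟩
    have h1 := hder ξ
    refine h1.trans ?_
    have h2 := hgy (mfderiv (𝓡 n) 𝓘(ℝ, EuclideanSpace ℝ (Fin d) × EuclideanSpace ℝ (Fin d))
        s y ξ : EuclideanSpace ℝ (Fin d) × EuclideanSpace ℝ (Fin d)).1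
        (mfderiv (𝓡 n) 𝓘(ℝ, EuclideanSpace ℝ (Fin d) × EuclideanSpace ℝ (Fin d))
        s y ξ : EuclideanSpace ℝ (Fin d) × EuclideanSpace ℝ (Fin d)).2
    refine Eq.trans h2 ?_
    rw [hder1 ξ, hξ]
    have h3 := hgy q1 q2
    have h4 : g y (q1, q2) = v := congrArg Prod.fst hq
    exact h3.symm.trans h4

/-- **Remark after Theorem 2.3.** Theorem 2.3 holds with `ℝⁿ` replaced by any contractible
smooth manifold: if `Y` is a closed subset of a contractible smooth manifold `M` (Hausdorff,
second countable, without boundary, modeled on `ℝⁿ`) which is cut out, on an open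
neighborhood `U` of `Y`, by a `C^∞` map `f : U → ℝᵈ` (`d ∈ {1,2,4,8}`) with surjective
differential along `Y`, then there is a global `C^∞` map `F : M → ℝᵈ` with `Y = F⁻¹(0)`
and surjective differential at each point of `Y`. -/
theorem differentiable_complete_intersection_contractible_manifold
    (d n : ℕ) (hd : d ∈ ({1, 2, 4, 8} : Set ℕ))
    {M : Type*} [TopologicalSpace M] [ChartedSpace (EuclideanSpace ℝ (Fin n)) M]
    [IsManifold (𝓡 n) (⊤ : ℕ∞) M] [T2Space M] [SecondCountableTopology M]
    [ContractibleSpace M]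
    (Y U : Set M) (hYclosed : IsClosed Y) (hUopen : IsOpen U) (hYU : Y ⊆ U)
    (f : M → EuclideanSpace ℝ (Fin d))
    (hf : ContMDiffOn (𝓡 n) (𝓡 d) (⊤ : ℕ∞) f U)
    (hYzero : Y = {x ∈ U | f x = 0})
    (hfsurj : ∀ x ∈ Y, Function.Surjective (mfderiv (𝓡 n) (𝓡 d) f x)) :
    ∃ F : M → EuclideanSpace ℝ (Fin d),
      ContMDiff (𝓡 n) (𝓡 d) (⊤ : ℕ∞) F ∧
      Y = {x | F x = 0} ∧
      ∀ x ∈ Y, Function.Surjective (mfderiv (𝓡 n) (𝓡 d) F x) := by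
  rcases Y.eq_empty_or_nonempty with hYe | ⟨x₀, hx₀⟩
  · obtain ⟨_, _, e, he, -⟩ := dci_exists_mul d hd
    refine ⟨fun _ => e, contMDiff_const, ?_, ?_⟩
    · rw [hYe]; ext x; simp [he]
    · rw [hYe]; simp
  have : LocallyCompactSpace M := ChartedSpace.locallyCompactSpace (EuclideanSpace ℝ (Fin n)) M
  have : SigmaCompactSpace M := inferInstance
  obtain ⟨χ, hχ0, hχ1, -⟩ := exists_contMDiffMap_zero_one_nhds_of_isClosed (n := (⊤ : ℕ∞)) (𝓡 n)
    hUopen.isClosed_compl hYclosed (Set.disjoint_left.2 fun x hx hY => hx (hYU hY))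
  have hχY : ∀ x ∈ Y, χ x = 1 := fun x hx => hχ1.self_of_nhdsSet x hx
  have hχU : ∀ x, χ x ≠ 0 → x ∈ U := fun x hx => by
    by_contra h
    exact hx (hχ0.self_of_nhdsSet x h)
  have hfY : ∀ x ∈ Y, f x = 0 := fun x hx => by
    rw [hYzero] at hx; exact hx.2
  have hYf : ∀ x ∈ U, f x = 0 → x ∈ Y := fun x hx h => by
    rw [hYzero]; exact ⟨hx, h⟩
  have hβ : ContMDiff (𝓡 n) (𝓡 d) (⊤ : ℕ∞) (fun x => χ x • f x) := by
    intro x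
    by_cases hx : x ∈ U
    · exact (χ.contMDiff x).smul ((hf x hx).contMDiffAt (hUopen.mem_nhds hx))
    · have hev : ∀ᶠ y in nhds x, χ y = 0 := hχ0.filter_mono (nhds_le_nhdsSet hx)
      refine (contMDiffAt_const (c := (0 : EuclideanSpace ℝ (Fin d)))).congr_of_eventuallyEq ?_
      filter_upwards [hev] with y hy
      simp [hy]
  have hr : ∀ x, 0 < (2 * χ x - 1) ^ 2 + ‖χ x • f x‖ ^ 2 := by
    intro x
    by_contra hcon
    have h1 : (2 * χ x - 1) ^ 2 = 0 := by nlinarith [sq_nonneg (2 * χ x - 1), sq_nonneg ‖χ x • f x‖]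
    have h2 : ‖χ x • f x‖ ^ 2 = 0 := by
      nlinarith [sq_nonneg (2 * χ x - 1), sq_nonneg ‖χ x • f x‖]
    have h3 : χ x = 1 / 2 := by
      have := pow_eq_zero_iff (two_ne_zero) |>.1 h1
      linarith
    have h4 : χ x • f x = 0 := by simpa using h2
    have h5 : χ x ≠ 0 := by rw [h3]; norm_num
    have h6 : f x = 0 := (smul_eq_zero.1 h4).resolve_left h5
    have h7 := hχY x (hYf x (hχU x h5) h6)
    rw [h3] at h7
    norm_num at h7
  set ρ : M → ℝ := fun x => (√((2 * χ x - 1) ^ 2 + ‖χ x • f x‖ ^ 2))⁻¹ with hρ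
  have hρpos : ∀ x, 0 < ρ x := fun x => inv_pos.2 (Real.sqrt_pos.2 (hr x))
  have hρsq : ∀ x, ρ x ^ 2 * ((2 * χ x - 1) ^ 2 + ‖χ x • f x‖ ^ 2) = 1 := by
    intro x
    simp only [hρ]
    rw [inv_pow, Real.sq_sqrt (hr x).le, inv_mul_cancel₀ (hr x).ne']
  have hρs : ContMDiff (𝓡 n) 𝓘(ℝ, ℝ) (⊤ : ℕ∞) ρ := by
    intro x
    have hΦ : ContDiffAt ℝ (⊤ : ℕ∞) (fun q : ℝ × EuclideanSpace ℝ (Fin d) =>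
        (√((2 * q.1 - 1) ^ 2 + ‖q.2‖ ^ 2))⁻¹) (χ x, χ x • f x) := by
      refine ContDiffAt.inv (ContDiffAt.sqrt ?_ (hr x).ne') (Real.sqrt_pos.2 (hr x)).ne'
      have h1 : ContDiff ℝ (⊤ : ℕ∞) fun q : ℝ × EuclideanSpace ℝ (Fin d) => ‖q.2‖ ^ 2 :=
        contDiff_snd.norm_sq ℝ
      have h2 : ContDiff ℝ (⊤ : ℕ∞) fun q : ℝ × EuclideanSpace ℝ (Fin d) =>
        (2 * q.1 - 1) ^ 2 := by fun_prop
      exact (h2.add h1).contDiffAt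
    have hp := (χ.contMDiff x).prodMk_space (hβ x)
    exact ContMDiffAt.comp (g := fun q : ℝ × EuclideanSpace ℝ (Fin d) =>
        (√((2 * q.1 - 1) ^ 2 + ‖q.2‖ ^ 2))⁻¹) x hΦ.contMDiffAt hp
  have hρY : ∀ x ∈ Y, ρ x = 1 := by
    intro x hx
    simp only [hρ, hχY x hx, hfY x hx]
    norm_num
  have haY : ∀ x, ρ x * (2 * χ x - 1) = 1 ↔ x ∈ Y := by
    intro x
    constructor
    · intro h
      have h1 := hρsq x
      have h2 : ρ x ^ 2 * ‖χ x • f x‖ ^ 2 = 0 := by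
        have : ρ x ^ 2 * (2 * χ x - 1) ^ 2 = 1 := by rw [← mul_pow, h, one_pow]
        linarith
      have h3 : χ x • f x = 0 := by
        have := (mul_eq_zero.1 h2).resolve_left (pow_ne_zero 2 (hρpos x).ne')
        simpa using this
      have h5 : χ x ≠ 0 := by
        intro h0
        rw [h0] at h
        linarith [hρpos x]
      exact hYf x (hχU x h5) ((smul_eq_zero.1 h3).resolve_left h5)
    · intro hx
      rw [hρY x hx, hχY x hx]
      norm_num
  have hne : ((⊤ : ℕ∞) : WithTop ℕ∞) ≠ 0 := by simp
  obtain ⟨F, hFs, hF0, hFd⟩ := dci_main hd (fun x => ρ x * (2 * χ x - 1))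
    (fun x => ρ x • (χ x • f x))
    (by
      have hΦ : ContDiff ℝ (⊤ : ℕ∞) (fun q : ℝ × ℝ => q.1 * (2 * q.2 - 1)) := by fun_prop
      exact hΦ.contMDiff.comp (hρs.prodMk_space χ.contMDiff))
    (hρs.smul hβ)
    (fun x => by
      rw [norm_smul, mul_pow, mul_pow, Real.norm_eq_abs, sq_abs, ← mul_add]
      exact hρsq x)
    (fun y hy => by
      rw [haY] at hy
      have hfy : MDifferentiableAt (𝓡 n) (𝓡 d) f y :=
        ((hf y (hYU hy)).contMDiffAt (hUopen.mem_nhds (hYU hy))).mdifferentiableAt hne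
      have hg : ContMDiff (𝓡 n) 𝓘(ℝ, EuclideanSpace ℝ (Fin d) →L[ℝ] EuclideanSpace ℝ (Fin d))
          (⊤ : ℕ∞) (fun x => (ρ x * χ x) •
            ContinuousLinearMap.id ℝ (EuclideanSpace ℝ (Fin d))) :=
        (hρs.mul χ.contMDiff).smul contMDiff_const
      have hder := dci_hasMFDerivAt _ f y ((hg y).mdifferentiableAt hne) hfy (hfY y hy)
      have hfun : (fun x => ρ x • (χ x • f x)) = fun x => ((ρ x * χ x) •
            ContinuousLinearMap.id ℝ (EuclideanSpace ℝ (Fin d))) (f x) := by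
        funext x
        simp [smul_smul]
      rw [hfun]
      intro v
      obtain ⟨ξ, hξ⟩ := hfsurj y hy v
      refine ⟨ξ, (hder ξ).trans ?_⟩
      rw [hρY y hy, hχY y hy, one_mul, one_smul]
      exact hξ)
    x₀ ((haY x₀).2 hx₀)
  refine ⟨F, hFs, ?_, fun x hx => hFd x ((haY x).2 hx)⟩
  ext x
  rw [Set.mem_ofPred_eq, hF0, haY]
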